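/- arXiv:2405.19380 — 2 statements merged into one kernel-verified Lean document; each statement's English description precedes it below -/
import Mathlib

section
/- Let n, d ≥ 1, λ > 0 and let z_1, …, z_{t-1} ∈ ℝ^d be vectors and H_1, …, H_{t-1} ∈ ℝ^{n×n} be symmetric matrices such that m̲·I_n ⪯ H_s ⪯ m̄·I_n for all s, where m̲, m̄ > 0. Define the (dn)×(dn) matrices Hess := λ·I_{dn} + Σ_{s=1}^{t-1} H_s ⊗ (z_s z_sᵀ) and P := λ·I_{dn} + Σ_{s=1}^{t-1} I_n ⊗ (z_s z_sᵀ), where ⊗ denotes the Kronecker product. Then, with m := min{m̲, 1} and M := max{m̄, 1}, one has m·P ⪯ Hess ⪯ M·P. -/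
open Matrix
open scoped Kronecker

/-- A nonnegative multiple of the identity plus a sum of Kronecker products of positive semidefinite
matrices with rank-one matrices `z zᵀ` is positive semidefinite. -/
theorem posSemidef_smul_one_add_sum_kronecker_vecMulVec {ι n d : Type*} [Fintype ι] [Fintype n]
    [Fintype d] [DecidableEq n] [DecidableEq d] {c : ℝ} (hc : 0 ≤ c) {K : ι → Matrix n n ℝ}
    (hK : ∀ s, (K s).PosSemidef) (z : ι → d → ℝ) :
    (c • (1 : Matrix (n × d) (n × d) ℝ) +
      ∑ s, K s ⊗ₖ Matrix.vecMulVec (z s) (z s)).PosSemidef := by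
  refine (Matrix.PosSemidef.one.smul hc).add (Matrix.posSemidef_sum _ fun s _ => ?_)
  exact (hK s).kronecker (by simpa using Matrix.posSemidef_vecMulVec_self_star (z s))

/-- With `Hess = λ·I + Σₛ Hₛ ⊗ (zₛ zₛᵀ)` and `P = λ·I + Σₛ Iₙ ⊗ (zₛ zₛᵀ)`,
if `m̲·I ⪯ Hₛ ⪯ m̄·I` for symmetric `Hₛ`, then `m·P ⪯ Hess ⪯ M·P` where
`m = min m̲ 1` and `M = max m̄ 1`. -/
theorem preconditioner_hessian_bounds {n d t : ℕ} (hn : 1 ≤ n) (hd : 1 ≤ d)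
    (lam : ℝ) (hlam : 0 < lam)
    (z : Fin t → Fin d → ℝ) (H : Fin t → Matrix (Fin n) (Fin n) ℝ)
    (m₁ m₂ : ℝ) (hm₁ : 0 < m₁) (hm₂ : 0 < m₂)
    (hsym : ∀ s, (H s).IsHermitian)
    (hlow : ∀ s, (H s - m₁ • (1 : Matrix (Fin n) (Fin n) ℝ)).PosSemidef)
    (hupp : ∀ s, (m₂ • (1 : Matrix (Fin n) (Fin n) ℝ) - H s).PosSemidef) :
    let Hess : Matrix (Fin n × Fin d) (Fin n × Fin d) ℝ :=
      lam • 1 + ∑ s, (H s) ⊗ₖ Matrix.vecMulVec (z s) (z s)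
    let P : Matrix (Fin n × Fin d) (Fin n × Fin d) ℝ :=
      lam • 1 + ∑ s, (1 : Matrix (Fin n) (Fin n) ℝ) ⊗ₖ Matrix.vecMulVec (z s) (z s)
    (Hess - (min m₁ 1) • P).PosSemidef ∧ ((max m₂ 1) • P - Hess).PosSemidef := by
  intro Hess P
  constructor
  · have hK : ∀ s, (H s - min m₁ 1 • (1 : Matrix (Fin n) (Fin n) ℝ)).PosSemidef := fun s => by
      convert (hlow s).add (Matrix.PosSemidef.one.smul (sub_nonneg.2 (min_le_left m₁ 1))) using 1
      module
    have hc : 0 ≤ (1 - min m₁ 1) * lam :=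
      mul_nonneg (sub_nonneg.2 (min_le_right m₁ 1)) hlam.le
    convert posSemidef_smul_one_add_sum_kronecker_vecMulVec hc hK z using 1
    simp only [Hess, P, sub_eq_add_neg, Matrix.add_kronecker, Finset.sum_add_distrib, ← neg_smul,
      Matrix.smul_kronecker, ← Finset.smul_sum]
    module
  · have hK : ∀ s, (max m₂ 1 • (1 : Matrix (Fin n) (Fin n) ℝ) - H s).PosSemidef := fun s => by
      convert (hupp s).add (Matrix.PosSemidef.one.smul (sub_nonneg.2 (le_max_left m₂ 1))) using 1
      module
    have hc : 0 ≤ (max m₂ 1 - 1) * lam :=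
      mul_nonneg (sub_nonneg.2 (le_max_right m₂ 1)) hlam.le
    convert posSemidef_smul_one_add_sum_kronecker_vecMulVec hc hK z using 1
    simp only [Hess, P, sub_eq_add_neg, Matrix.add_kronecker, Finset.sum_add_distrib,
      ← neg_one_smul ℝ (H _), Matrix.smul_kronecker, ← Finset.smul_sum]
    module
end

section
/- Let (z_s)_{s=1}^t, (y_s)_{s=1}^t and (ψ_s)_{s=1}^t be vectors in ℝ^d satisfying z_s = y_s + ψ_s for all s. Then for every λ̃ > 0, every t ≥ 1 and every ε ∈ (0, 1], one has Σ_{s=1}^t z_s z_sᵀ ⪰ Σ_{s=1}^t ψ_s ψ_sᵀ + (1 − ε)·Σ_{s=1}^t y_s y_sᵀ − (1/ε)·(Σ_{s=1}^t y_s ψ_sᵀ)ᵀ (λ̃·I_d + Σ_{s=1}^t y_s y_sᵀ)^{−1} (Σ_{s=1}^t y_s ψ_sᵀ) − ε·λ̃·I_d. -/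
open Matrix

/-- Completing the square: for `V` positive definite,
`ε V + M + Mᵀ + ε⁻¹ Mᵀ V⁻¹ M = (ε V + M)ᵀ (ε⁻¹ V⁻¹) (ε V + M)` is positive semidefinite. -/
theorem Matrix.PosDef.posSemidef_smul_add_add_transpose_add {n : Type*} [Fintype n]
    [DecidableEq n] {V : Matrix n n ℝ} (hV : V.PosDef) (M : Matrix n n ℝ) {ε : ℝ}
    (hε : 0 < ε) :
    (ε • V + M + Mᵀ + ε⁻¹ • (Mᵀ * V⁻¹ * M)).PosSemidef := by
  have hdet : IsUnit V.det := (Matrix.isUnit_iff_isUnit_det V).mp hV.isUnit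
  have hVt : Vᵀ = V := by simpa [conjTranspose_eq_transpose_of_trivial] using hV.isHermitian.eq
  have h := (hV.inv.posSemidef.smul (inv_nonneg.mpr hε.le)).conjTranspose_mul_mul_same (ε • V + M)
  suffices hsq : ε • V + M + Mᵀ + ε⁻¹ • (Mᵀ * V⁻¹ * M) =
      (ε • V + M)ᴴ * ε⁻¹ • V⁻¹ * (ε • V + M) by
    rw [hsq]
    exact h
  simp only [conjTranspose_eq_transpose_of_trivial, transpose_add, transpose_smul, hVt,
    add_mul, mul_add, smul_mul_assoc, mul_smul_comm, mul_nonsing_inv _ hdet,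
    Matrix.mul_assoc, nonsing_inv_mul _ hdet,
    Matrix.mul_one, smul_smul, smul_add]
  simp only [inv_mul_cancel₀ hε.ne', mul_inv_cancel₀ hε.ne', one_smul, mul_one, one_mul]
  abel

/-- (Lemma 10 in Jedra–Proutiere.) If `zₛ = yₛ + ψₛ`, then for all `λ̃ > 0`,
`t ≥ 1` and `ε ∈ (0,1]`,
`Σ zₛ zₛᵀ ⪰ Σ ψₛ ψₛᵀ + (1−ε)·Σ yₛ yₛᵀ − (1/ε)·(Σ yₛ ψₛᵀ)ᵀ (λ̃ I + Σ yₛ yₛᵀ)⁻¹ (Σ yₛ ψₛᵀ) − ε λ̃ I`. -/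
theorem preconditioner_expansion {d t : ℕ} (ht : 1 ≤ t)
    (z y ψ : Fin t → Fin d → ℝ) (hz : ∀ s, z s = y s + ψ s)
    (lam ε : ℝ) (hlam : 0 < lam) (hε : ε ∈ Set.Ioc (0 : ℝ) 1) :
    ((∑ s, Matrix.vecMulVec (z s) (z s)) -
      ((∑ s, Matrix.vecMulVec (ψ s) (ψ s)) +
        (1 - ε) • (∑ s, Matrix.vecMulVec (y s) (y s)) -
        ε⁻¹ • ((∑ s, Matrix.vecMulVec (y s) (ψ s))ᵀ *
            (lam • 1 + ∑ s, Matrix.vecMulVec (y s) (y s))⁻¹ *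
            (∑ s, Matrix.vecMulVec (y s) (ψ s))) -
        (ε * lam) • (1 : Matrix (Fin d) (Fin d) ℝ))).PosSemidef := by
  obtain ⟨hε, -⟩ := hε
  have hY : (∑ s, vecMulVec (y s) (y s)).PosSemidef :=
    posSemidef_sum _ fun s _ => by simpa using posSemidef_vecMulVec_self_star (y s)
  have hV : (lam • (1 : Matrix (Fin d) (Fin d) ℝ) + ∑ s, vecMulVec (y s) (y s)).PosDef :=
    (PosDef.one.smul hlam).add_posSemidef hY
  convert hV.posSemidef_smul_add_add_transpose_add (∑ s, vecMulVec (y s) (ψ s)) hε using 1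
  have hZ : ∑ s, vecMulVec (z s) (z s) = ∑ s, vecMulVec (y s) (y s) +
      ∑ s, vecMulVec (y s) (ψ s) + (∑ s, vecMulVec (y s) (ψ s))ᵀ +
      ∑ s, vecMulVec (ψ s) (ψ s) := by
    simp only [hz, transpose_sum, transpose_vecMulVec, ← Finset.sum_add_distrib,
      add_vecMulVec, vecMulVec_add]
    exact Finset.sum_congr rfl fun s _ => by abel
  rw [hZ]
  module
end
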